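/- There exist nonempty regular closed subsets a, b, x, y, u, v of some Euclidean space ℝ^m satisfying EC(a,b), TPP(x,a), TPP(y,a), TPP(u,b), TPP(v,b), DC(x,y), DC(u,v), EC(x,u), EC(x,v), EC(y,u), EC(y,v); but there do not exist nonempty convex regular closed subsets a, b, x, y, u, v of ℝ² satisfying all of these eleven relations. (There is a consistent RCC8 network with 6 = 2·2+2 variables which has no convex solution in ℝ².) -/

import Mathlib

/-- A set is regular closed if it equals the closure of its interior. -/
def RegClosed {α : Type*} [TopologicalSpace α] (X : Set α) : Prop :=
  closure (interior X) = X

/-- RCC8: disconnected. -/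
def DC {α : Type*} (a b : Set α) : Prop := a ∩ b = ∅

/-- RCC8: externally connected. -/
def EC {α : Type*} [TopologicalSpace α] (a b : Set α) : Prop :=
  (a ∩ b).Nonempty ∧ interior a ∩ interior b = ∅

/-- RCC8: partially overlaps. -/
def PO {α : Type*} [TopologicalSpace α] (a b : Set α) : Prop :=
  (interior a ∩ interior b).Nonempty ∧ ¬ a ⊆ b ∧ ¬ b ⊆ a

/-- RCC8: tangential proper part. -/
def TPP {α : Type*} [TopologicalSpace α] (a b : Set α) : Prop :=
  a ⊂ b ∧ ¬ a ⊆ interior b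

/-- RCC8: non-tangential proper part. -/
def NTPP {α : Type*} [TopologicalSpace α] (a b : Set α) : Prop :=
  a ⊆ interior b ∧ a ≠ b

/-- RCC5: discrete from. -/
def DR {α : Type*} [TopologicalSpace α] (a b : Set α) : Prop :=
  interior a ∩ interior b = ∅

/-- RCC5: proper part. -/
def PP {α : Type*} (a b : Set α) : Prop := a ⊂ b

open Set

section General

variable {α : Type*} [TopologicalSpace α] {a b x u : Set α}

lemma RegClosed.notMem_interior {p : α} (hb : RegClosed b)
    (hab : interior a ∩ interior b = ∅) (hp : p ∈ b) : p ∉ interior a := by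
  intro hpa
  rw [← hb] at hp
  obtain ⟨q, hqa, hqb⟩ := mem_closure_iff.1 hp _ isOpen_interior hpa
  exact (hab ▸ ⟨hqa, hqb⟩ : q ∈ (∅ : Set α))

lemma EC.of_subset (hab : EC a b) (hx : x ⊆ a) (hu : u ⊆ b) (h : (x ∩ u).Nonempty) : EC x u :=
  ⟨h, subset_empty_iff.1 <| hab.2 ▸ inter_subset_inter (interior_mono hx) (interior_mono hu)⟩

lemma EC.symm (hab : EC a b) : EC b a :=
  ⟨inter_comm a b ▸ hab.1, inter_comm (interior a) _ ▸ hab.2⟩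

lemma EC.tpp (hab : EC a b) (hb : RegClosed b) (hx : x ⊂ a) (h : (x ∩ b).Nonempty) : TPP x a := by
  obtain ⟨p, hpx, hpb⟩ := h
  exact ⟨hx, fun hxa => hb.notMem_interior hab.2 hpb (hxa hpx)⟩

lemma RegClosed.interior_nonempty (ha : RegClosed a) (h : a.Nonempty) : (interior a).Nonempty := by
  rwa [← ha, closure_nonempty_iff] at h

end General

lemma Convex.regClosed {E : Type*} [AddCommGroup E] [Module ℝ E] [TopologicalSpace E]
    [IsTopologicalAddGroup E] [ContinuousSMul ℝ E] {s : Set E} (hs : Convex ℝ s)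
    (hc : IsClosed s) (h : (interior s).Nonempty) : RegClosed s :=
  (hs.closure_interior_eq_closure_of_nonempty_interior h).trans hc.closure_eq

/-- The closed half-space `0 ≤ t * p 2`. -/
def halfSpace (t : ℝ) : Set (EuclideanSpace ℝ (Fin 3)) := {p | 0 ≤ t * p 2}

/-- The wedge `1 ≤ s * p i`, `0 ≤ t * p 2`. -/
def wedge (i : Fin 3) (s t : ℝ) : Set (EuclideanSpace ℝ (Fin 3)) := {p | 1 ≤ s * p i} ∩ halfSpace t

lemma convex_setOf_le_mul_coord (i : Fin 3) (c s : ℝ) :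
    Convex ℝ {p : EuclideanSpace ℝ (Fin 3) | c ≤ s * p i} :=
  convex_halfSpace_ge (f := fun p : EuclideanSpace ℝ (Fin 3) => s * p i)
    ⟨fun p q => by simp [mul_add], fun r p => by simp [mul_left_comm]⟩ c

lemma isClosed_setOf_le_mul_coord (i : Fin 3) (c s : ℝ) :
    IsClosed {p : EuclideanSpace ℝ (Fin 3) | c ≤ s * p i} :=
  isClosed_le (by fun_prop) (by fun_prop)

lemma mem_interior_setOf_le_mul_coord {i : Fin 3} {c s : ℝ} {p : EuclideanSpace ℝ (Fin 3)}
    (h : c < s * p i) : p ∈ interior {p : EuclideanSpace ℝ (Fin 3) | c ≤ s * p i} :=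
  interior_maximal (s := {p : EuclideanSpace ℝ (Fin 3) | c ≤ s * p i})
    (t := {p | c < s * p i}) (fun q (hq : c < s * q i) => hq.le)
    (isOpen_lt (by fun_prop) (by fun_prop)) h

lemma regClosed_halfSpace {t : ℝ} (ht : t ≠ 0) : RegClosed (halfSpace t) := by
  refine (convex_setOf_le_mul_coord 2 0 t).regClosed (isClosed_setOf_le_mul_coord 2 0 t)
    ⟨EuclideanSpace.single 2 t, mem_interior_setOf_le_mul_coord ?_⟩
  simpa using mul_self_pos.2 ht

lemma regClosed_wedge {i : Fin 3} (hi : i ≠ 2) {s t : ℝ} (hs : s ≠ 0) (ht : t ≠ 0) :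
    RegClosed (wedge i s t) := by
  refine ((convex_setOf_le_mul_coord i 1 s).inter (convex_setOf_le_mul_coord 2 0 t)).regClosed
    ((isClosed_setOf_le_mul_coord i 1 s).inter (isClosed_setOf_le_mul_coord 2 0 t))
    ⟨EuclideanSpace.single 2 t + EuclideanSpace.single i (2 / s), ?_⟩
  rw [interior_inter]
  constructor <;> apply mem_interior_setOf_le_mul_coord
  · simp [hi, mul_div_cancel₀ _ hs]
  · simpa [hi.symm] using ht

lemma ec_halfSpace : EC (halfSpace 1) (halfSpace (-1)) := by
  refine ⟨⟨0, by simp [halfSpace]⟩, ?_⟩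
  let π : EuclideanSpace ℝ (Fin 3) →L[ℝ] ℝ := EuclideanSpace.proj 2
  have hπ : IsOpenMap π := π.isOpenMap fun r => ⟨EuclideanSpace.single 2 r, by simp [π]⟩
  have h : halfSpace 1 ∩ halfSpace (-1) = π ⁻¹' {0} := by
    ext p
    simp [halfSpace, π, le_antisymm_iff, and_comm]
  rw [← interior_inter, h, ← hπ.preimage_interior_eq_interior_preimage π.continuous]
  simp

lemma wedge_ssubset_halfSpace (i : Fin 3) (s t : ℝ) : wedge i s t ⊂ halfSpace t :=
  ⟨inter_subset_right, fun h => by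
    have := h (show (0 : EuclideanSpace ℝ (Fin 3)) ∈ halfSpace t by simp [halfSpace])
    norm_num [wedge] at this⟩

lemma wedge_inter_wedge_neg (i : Fin 3) (t : ℝ) : wedge i 1 t ∩ wedge i (-1) t = ∅ := by
  ext p
  simp only [wedge, mem_inter_iff, mem_ofPred_eq, mem_empty_iff_false, iff_false]
  rintro ⟨⟨h, -⟩, h', -⟩
  linarith

lemma wedge_zero_inter_wedge_one {s s' : ℝ} (hs : s ≠ 0) (hs' : s' ≠ 0) (t t' : ℝ) :
    (wedge 0 s t ∩ wedge 1 s' t').Nonempty :=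
  ⟨!₂[s⁻¹, s'⁻¹, 0], by simp [wedge, halfSpace, hs, hs']⟩

lemma ordConnected_inter_nonempty {X Y U V : Set ℝ} (hX : X.OrdConnected) (hY : Y.OrdConnected)
    (hU : U.OrdConnected) (hV : V.OrdConnected) (hXU : (X ∩ U).Nonempty) (hXV : (X ∩ V).Nonempty)
    (hYU : (Y ∩ U).Nonempty) (hYV : (Y ∩ V).Nonempty) (hXY : X ∩ Y = ∅) :
    (U ∩ V).Nonempty := by
  obtain ⟨p, hpX, hpU⟩ := hXU
  obtain ⟨q, hqX, hqV⟩ := hXV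
  obtain ⟨r, hrY, hrU⟩ := hYU
  obtain ⟨s, hsY, hsV⟩ := hYV
  have hX := @hX.out
  have hY := @hY.out
  have hU := @hU.out
  have hV := @hV.out
  by_contra! h
  simp only [Set.ext_iff, Set.subset_def, mem_inter_iff, mem_Icc, mem_empty_iff_false] at *
  have := le_total p q
  have := le_total r s
  have := le_total p r
  have := le_total q s
  have := le_total p s
  have := le_total q r
  grind

lemma exists_separating_functional {E : Type*} [AddCommGroup E] [Module ℝ E] [TopologicalSpace E]
    [IsTopologicalAddGroup E] [ContinuousSMul ℝ E] {a b : Set E} (ha : Convex ℝ a)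
    (hb : Convex ℝ b) (hra : RegClosed a) (hrb : RegClosed b) (hna : a.Nonempty)
    (hnb : b.Nonempty) (hab : interior a ∩ interior b = ∅) :
    ∃ (f : E →L[ℝ] ℝ) (c : ℝ), f ≠ 0 ∧ (∀ p ∈ a, f p ≤ c) ∧ ∀ p ∈ b, c ≤ f p := by
  obtain ⟨f, c, hfa, hfb⟩ := geometric_hahn_banach_open ha.interior isOpen_interior hb.interior
    (disjoint_iff_inter_eq_empty.2 hab)
  refine ⟨f, c, ?_, ?_, ?_⟩
  · rintro rfl
    obtain ⟨p, hp⟩ := hra.interior_nonempty hna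
    obtain ⟨q, hq⟩ := hrb.interior_nonempty hnb
    have := hfa p hp
    have := hfb q hq
    simp_all
    linarith
  · intro p hp
    rw [← hra] at hp
    exact closure_minimal (fun q hq => (hfa q hq).le)
      (isClosed_le f.continuous continuous_const) hp
  · intro p hp
    rw [← hrb] at hp
    exact closure_minimal hfb (isClosed_le continuous_const f.continuous) hp

lemma exists_injOn_level {f : EuclideanSpace ℝ (Fin 2) →L[ℝ] ℝ} (hf : f ≠ 0) (c : ℝ) :
    ∃ g : EuclideanSpace ℝ (Fin 2) →ₗ[ℝ] ℝ, InjOn g {p | f p = c} := by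
  set α := f (EuclideanSpace.single 0 1) with hα
  set β := f (EuclideanSpace.single 1 1) with hβ
  have hfp (p : EuclideanSpace ℝ (Fin 2)) : f p = α * p 0 + β * p 1 := by
    have : p = p 0 • EuclideanSpace.single 0 1 + p 1 • EuclideanSpace.single 1 1 := by
      ext i
      fin_cases i <;> simp
    conv_lhs => rw [this]
    simp only [map_add, map_smul, smul_eq_mul, ← hα, ← hβ]
    ring
  have hpos : α ^ 2 + β ^ 2 ≠ 0 := by
    intro h
    have h0 : α = 0 := by nlinarith [sq_nonneg α, sq_nonneg β]
    have h1 : β = 0 := by nlinarith [sq_nonneg α, sq_nonneg β]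
    exact hf (ContinuousLinearMap.ext fun p => by simp [hfp, h0, h1])
  refine ⟨α • (EuclideanSpace.proj 1 : _ →L[ℝ] ℝ).toLinearMap
    - β • (EuclideanSpace.proj 0 : _ →L[ℝ] ℝ).toLinearMap, fun p hp q hq hpq => ?_⟩
  simp only [mem_ofPred_eq, hfp] at hp hq
  simp at hpq
  ext i
  apply mul_left_cancel₀ hpos
  fin_cases i
  · change (α ^ 2 + β ^ 2) * p 0 = (α ^ 2 + β ^ 2) * q 0
    linear_combination α * (hp - hq) - β * hpq
  · change (α ^ 2 + β ^ 2) * p 1 = (α ^ 2 + β ^ 2) * q 1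
    linear_combination β * (hp - hq) + α * hpq

lemma Convex.planar_inter_nonempty {a b x y u v : Set (EuclideanSpace ℝ (Fin 2))}
    (ha : Convex ℝ a) (hb : Convex ℝ b) (hx : Convex ℝ x) (hy : Convex ℝ y) (hu : Convex ℝ u)
    (hv : Convex ℝ v) (hra : RegClosed a) (hrb : RegClosed b)
    (hab : EC a b) (hxa : x ⊆ a) (hya : y ⊆ a) (hub : u ⊆ b) (hvb : v ⊆ b)
    (hxy : x ∩ y = ∅) (hxu : (x ∩ u).Nonempty) (hxv : (x ∩ v).Nonempty) (hyu : (y ∩ u).Nonempty)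
    (hyv : (y ∩ v).Nonempty) : (u ∩ v).Nonempty := by
  obtain ⟨f, c, hf, hfa, hfb⟩ := exists_separating_functional ha hb hra hrb hab.1.left
    hab.1.right hab.2
  obtain ⟨g, hg⟩ := exists_injOn_level hf c
  set L := {p | f p = c}
  have hL : Convex ℝ L := convex_hyperplane f.toLinearMap.isLinear c
  have hoc {s : Set (EuclideanSpace ℝ (Fin 2))} (hs : Convex ℝ s) :
      (g '' (s ∩ L)).OrdConnected := ((hs.inter hL).linear_image g).ordConnected
  have hmeet {s t : Set (EuclideanSpace ℝ (Fin 2))} (hs : s ⊆ a) (ht : t ⊆ b)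
      (h : (s ∩ t).Nonempty) : (g '' (s ∩ L) ∩ g '' (t ∩ L)).Nonempty := by
    obtain ⟨p, hps, hpt⟩ := h
    have hp : p ∈ L := le_antisymm (hfa p (hs hps)) (hfb p (ht hpt))
    exact ⟨g p, mem_image_of_mem g ⟨hps, hp⟩, mem_image_of_mem g ⟨hpt, hp⟩⟩
  have himage (s t : Set (EuclideanSpace ℝ (Fin 2))) :
      g '' (s ∩ L) ∩ g '' (t ∩ L) = g '' (s ∩ t ∩ L) := by
    rw [← hg.image_inter inter_subset_right inter_subset_right, ← inter_inter_distrib_right]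
  have h := ordConnected_inter_nonempty (hoc hx) (hoc hy) (hoc hu) (hoc hv) (hmeet hxa hub hxu)
    (hmeet hxa hvb hxv) (hmeet hya hub hyu) (hmeet hya hvb hyv) (by rw [himage, hxy]; simp)
  rw [himage] at h
  exact h.of_image.left

/-- There is a consistent RCC8 network with 6 = 2·2+2 variables which has no
convex solution in ℝ². -/
theorem statement18 :
    (∃ (m : ℕ) (a b x y u v : Set (EuclideanSpace ℝ (Fin m))),
      a.Nonempty ∧ b.Nonempty ∧ x.Nonempty ∧ y.Nonempty ∧ u.Nonempty ∧ v.Nonempty ∧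
      RegClosed a ∧ RegClosed b ∧ RegClosed x ∧
      RegClosed y ∧ RegClosed u ∧ RegClosed v ∧
      EC a b ∧ TPP x a ∧ TPP y a ∧ TPP u b ∧ TPP v b ∧
      DC x y ∧ DC u v ∧ EC x u ∧ EC x v ∧ EC y u ∧ EC y v) ∧
    ¬ (∃ a b x y u v : Set (EuclideanSpace ℝ (Fin 2)),
      a.Nonempty ∧ b.Nonempty ∧ x.Nonempty ∧ y.Nonempty ∧ u.Nonempty ∧ v.Nonempty ∧
      Convex ℝ a ∧ Convex ℝ b ∧ Convex ℝ x ∧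
      Convex ℝ y ∧ Convex ℝ u ∧ Convex ℝ v ∧
      RegClosed a ∧ RegClosed b ∧ RegClosed x ∧
      RegClosed y ∧ RegClosed u ∧ RegClosed v ∧
      EC a b ∧ TPP x a ∧ TPP y a ∧ TPP u b ∧ TPP v b ∧
      DC x y ∧ DC u v ∧ EC x u ∧ EC x v ∧ EC y u ∧ EC y v) := by
  constructor
  · have h1 : (1 : ℝ) ≠ 0 := one_ne_zero
    have hn : (-1 : ℝ) ≠ 0 := neg_ne_zero.2 h1
    have h0 : (0 : Fin 3) ≠ 2 := by decide
    have h12 : (1 : Fin 3) ≠ 2 := by decide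
    have hxu := wedge_zero_inter_wedge_one h1 h1 1 (-1)
    have hxv := wedge_zero_inter_wedge_one h1 hn 1 (-1)
    have hyu := wedge_zero_inter_wedge_one hn h1 1 (-1)
    have hyv := wedge_zero_inter_wedge_one hn hn 1 (-1)
    have hsub := fun i s t => wedge_ssubset_halfSpace i s t
    have hec := ec_halfSpace
    have htop {s : ℝ} (h : (wedge 0 s 1 ∩ wedge 1 1 (-1)).Nonempty) :
        TPP (wedge 0 s 1) (halfSpace 1) :=
      hec.tpp (regClosed_halfSpace hn) (hsub ..) (h.mono (inter_subset_inter_right _ (hsub ..).1))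
    have hbot {s : ℝ} (h : (wedge 0 1 1 ∩ wedge 1 s (-1)).Nonempty) :
        TPP (wedge 1 s (-1)) (halfSpace (-1)) :=
      hec.symm.tpp (regClosed_halfSpace h1) (hsub ..)
        (inter_comm _ _ ▸ h.mono (inter_subset_inter_left _ (hsub ..).1))
    have hwedge {s s' : ℝ} (h : (wedge 0 s 1 ∩ wedge 1 s' (-1)).Nonempty) :
        EC (wedge 0 s 1) (wedge 1 s' (-1)) := hec.of_subset (hsub ..).1 (hsub ..).1 h
    exact ⟨3, halfSpace 1, halfSpace (-1), wedge 0 1 1, wedge 0 (-1) 1, wedge 1 1 (-1),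
      wedge 1 (-1) (-1), hec.1.left, hec.1.right, hxu.left, hyu.left, hxu.right, hxv.right,
      regClosed_halfSpace h1, regClosed_halfSpace hn, regClosed_wedge h0 h1 h1,
      regClosed_wedge h0 hn h1, regClosed_wedge h12 h1 hn, regClosed_wedge h12 hn hn,
      hec, htop hxu, htop hyu, hbot hxu, hbot hxv, wedge_inter_wedge_neg 0 1,
      wedge_inter_wedge_neg 1 (-1), hwedge hxu, hwedge hxv, hwedge hyu, hwedge hyv⟩
  · rintro ⟨a, b, x, y, u, v, -, -, -, -, -, -, ha, hb, hx, hy, hu, hv, hra, hrb, -, -, -, -,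
      hab, hxa, hya, hub, hvb, hxy, huv, hxu, hxv, hyu, hyv⟩
    exact (ha.planar_inter_nonempty hb hx hy hu hv hra hrb hab hxa.1.1 hya.1.1 hub.1.1 hvb.1.1
      hxy hxu.1 hxv.1 hyu.1 hyv.1).ne_empty huv
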